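/- Let L : ℝ^D × ℝ^D → ℝ be twice continuously differentiable, with velocity Hessian M(q,v) and energy E(q,v) = ⟨v, ∂L/∂v⟩ − L. Then every vertical null vector annihilates the energy: for every g ∈ ℝ^D with M(q,v)·g = 0, the derivative of E at (q,v) in the vertical direction (0,g) vanishes, i.e. dE(q,v)((0,g)) = 0. -/

import Mathlib

open Matrix

/-- Gradient of `L` in the velocity variables: `(∇_v L)_a = ∂L/∂v^a`. -/
noncomputable def gradV (D : ℕ) (L : (Fin D → ℝ) × (Fin D → ℝ) → ℝ)
    (u : (Fin D → ℝ) × (Fin D → ℝ)) : Fin D → ℝ :=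
  fun a => fderiv ℝ L u (0, Pi.single a 1)

/-- Gradient of a phase-space function in the position variables. -/
noncomputable def gradQ (D : ℕ) (f : (Fin D → ℝ) × (Fin D → ℝ) → ℝ)
    (u : (Fin D → ℝ) × (Fin D → ℝ)) : Fin D → ℝ :=
  fun a => fderiv ℝ f u (Pi.single a 1, 0)

/-- The fibre derivative (Legendre map) `FL(q,v) = (q, ∂L/∂v(q,v))`. -/
noncomputable def FL (D : ℕ) (L : (Fin D → ℝ) × (Fin D → ℝ) → ℝ) :
    (Fin D → ℝ) × (Fin D → ℝ) → (Fin D → ℝ) × (Fin D → ℝ) :=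
  fun u => (u.1, gradV D L u)

/-- The velocity Hessian `M_{ab} = ∂²L/∂v^a∂v^b`. -/
noncomputable def hessV (D : ℕ) (L : (Fin D → ℝ) × (Fin D → ℝ) → ℝ)
    (u : (Fin D → ℝ) × (Fin D → ℝ)) : Matrix (Fin D) (Fin D) ℝ :=
  Matrix.of fun a b =>
    fderiv ℝ (fun w => fderiv ℝ L w (0, Pi.single a 1)) u (0, Pi.single b 1)

/-- The antisymmetric matrix `F_{ab} = ∂²L/∂v^a∂q^b − ∂²L/∂v^b∂q^a`. -/
noncomputable def Fmat (D : ℕ) (L : (Fin D → ℝ) × (Fin D → ℝ) → ℝ)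
    (u : (Fin D → ℝ) × (Fin D → ℝ)) : Matrix (Fin D) (Fin D) ℝ :=
  Matrix.of fun a b =>
    fderiv ℝ (fun w => fderiv ℝ L w (0, Pi.single a 1)) u (Pi.single b 1, 0)
      - fderiv ℝ (fun w => fderiv ℝ L w (0, Pi.single b 1)) u (Pi.single a 1, 0)

/-- The energy `E(q,v) = ⟨v, ∂L/∂v⟩ − L(q,v)`. -/
noncomputable def energy (D : ℕ) (L : (Fin D → ℝ) × (Fin D → ℝ) → ℝ)
    (u : (Fin D → ℝ) × (Fin D → ℝ)) : ℝ :=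
  u.2 ⬝ᵥ gradV D L u - L u

/-- The presymplectic Lagrangian two-form
`Ω((Xq,Xv),(Yq,Yv)) = Σ F_{ab} Xq^a Yq^b + Σ M_{ab}(Xq^a Yv^b − Yq^a Xv^b)`
on `ℝ^D × ℝ^D`. -/
def Omega (D : ℕ) (M F : Matrix (Fin D) (Fin D) ℝ)
    (X Y : (Fin D → ℝ) × (Fin D → ℝ)) : ℝ :=
  X.1 ⬝ᵥ F.mulVec Y.1 + X.1 ⬝ᵥ M.mulVec Y.2 - Y.1 ⬝ᵥ M.mulVec X.2

/-- The canonical symplectic bilinear pairing `ω((a,b),(c,d)) = ⟨a,d⟩ − ⟨c,b⟩`. -/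
def omegaCan (D : ℕ) (X Y : (Fin D → ℝ) × (Fin D → ℝ)) : ℝ :=
  X.1 ⬝ᵥ Y.2 - Y.1 ⬝ᵥ X.2

theorem map_vertical_eq_sum (D : ℕ) (ℓ : (Fin D → ℝ) × (Fin D → ℝ) →L[ℝ] ℝ) (g : Fin D → ℝ) :
    ℓ (0, g) = ∑ b, g b * ℓ (0, Pi.single b 1) := by
  have h := (ℓ.comp (ContinuousLinearMap.inr ℝ (Fin D → ℝ) (Fin D → ℝ))).toLinearMap.pi_apply_eq_sum_univ g
  simpa [← Pi.single_apply, Pi.single_comm, funext_iff, smul_eq_mul] using h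

theorem fderiv_gradV_vertical (D : ℕ) (L : (Fin D → ℝ) × (Fin D → ℝ) → ℝ)
    (u : (Fin D → ℝ) × (Fin D → ℝ)) (g : Fin D → ℝ) (a : Fin D) :
    fderiv ℝ (fun w => gradV D L w a) u (0, g) = (hessV D L u).mulVec g a := by
  rw [map_vertical_eq_sum]
  simp only [Matrix.mulVec, dotProduct, hessV, Matrix.of_apply, gradV, mul_comm]

/-- The vertical derivative of the energy is `⟨v, M g⟩`. -/
theorem fderiv_energy_vertical (D : ℕ) (L : (Fin D → ℝ) × (Fin D → ℝ) → ℝ)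
    (hL : ContDiff ℝ 2 L) (u : (Fin D → ℝ) × (Fin D → ℝ)) (g : Fin D → ℝ) :
    fderiv ℝ (energy D L) u (0, g) = u.2 ⬝ᵥ (hessV D L u).mulVec g := by
  have hgrad (a : Fin D) : DifferentiableAt ℝ (fun w => gradV D L w a) u :=
    (((hL.fderiv_right (m := 1) (by norm_num)).differentiable (by norm_num)) u).clm_apply
      (differentiableAt_const _)
  have hcoord (a : Fin D) :
      HasFDerivAt (fun w : (Fin D → ℝ) × (Fin D → ℝ) => w.2 a)
        ((ContinuousLinearMap.proj a).comp (ContinuousLinearMap.snd ℝ (Fin D → ℝ) (Fin D → ℝ))) u :=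
    ((ContinuousLinearMap.proj (R := ℝ) (φ := fun _ : Fin D => ℝ) a).comp
      (ContinuousLinearMap.snd ℝ (Fin D → ℝ) (Fin D → ℝ))).hasFDerivAt
  have hE : HasFDerivAt (energy D L) _ u :=
    (HasFDerivAt.fun_sum (u := Finset.univ)
      fun a _ => (hcoord a).mul (hgrad a).hasFDerivAt).sub
      ((hL.differentiable (by norm_num)) u).hasFDerivAt
  have hL_vertical : fderiv ℝ L u (0, g) = ∑ a, gradV D L u a * g a := by
    rw [map_vertical_eq_sum]
    simp only [gradV, mul_comm]
  rw [hE.fderiv]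
  simp only [_root_.sub_apply, _root_.sum_apply,
    _root_.add_apply, _root_.smul_apply, smul_eq_mul,
    ContinuousLinearMap.comp_apply, ContinuousLinearMap.proj_apply,
    ContinuousLinearMap.coe_snd', fderiv_gradV_vertical, Finset.sum_add_distrib,
    hL_vertical, dotProduct, add_sub_cancel_right]

/-- **Theorem (vertical null directions annihilate the energy: `G E = 0`).**
For every `g` with `M(q,v)·g = 0`, the derivative of the energy in the vertical
direction `(0,g)` vanishes: `dE(q,v)((0,g)) = 0`. -/
theorem vertical_null_annihilates_energy (D : ℕ)
    (L : (Fin D → ℝ) × (Fin D → ℝ) → ℝ) (hL : ContDiff ℝ 2 L)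
    (u : (Fin D → ℝ) × (Fin D → ℝ)) :
    ∀ g : Fin D → ℝ, (hessV D L u).mulVec g = 0 →
      fderiv ℝ (energy D L) u ((0 : Fin D → ℝ), g) = 0 := by
  intro g hg
  rw [fderiv_energy_vertical D L hL, hg, dotProduct_zero]
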